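/- Let u : ℝ → ℝ be twice continuously differentiable with u''(x) + f(u(x)) = 0 for all x ≥ 0, u(0) = a, and u'(0) > √(2(F(1) − F(a))). Then there exists M₁ > 0 such that u(M₁) = 1 and a ≤ u(x) < 1 for all x ∈ [0, M₁). -/

import Mathlib

open Set Filter Topology

/-- The primitive `F(s) = ∫₀^s f(r) dr`. -/
noncomputable def F (f : ℝ → ℝ) (s : ℝ) : ℝ := ∫ r in (0:ℝ)..s, f r

/-- Bistable nonlinearity with balanced-positive integral. -/
def Bistable (f : ℝ → ℝ) (a : ℝ) : Prop :=
  ContDiff ℝ 1 f ∧ 0 < a ∧ a < 1 ∧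
  f 0 = 0 ∧ f a = 0 ∧ f 1 = 0 ∧
  (∀ s, 0 < s → s < a → f s < 0) ∧
  (∀ s, a < s → s < 1 → 0 < f s) ∧
  deriv f 0 < 0 ∧ 0 < deriv f a ∧ deriv f 1 < 0 ∧
  0 < ∫ s in (0:ℝ)..(1:ℝ), f s


/-- A continuous function that starts below `v` and reaches `v` at some nonnegative point
has a first hitting point of `v`. -/
theorem exists_first_hitting {g : ℝ → ℝ} (hg : Continuous g) {v : ℝ} (h0 : g 0 < v)
    {T : ℝ} (hT : 0 ≤ T) (hgT : v ≤ g T) :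
    ∃ M, 0 < M ∧ M ≤ T ∧ g M = v ∧ ∀ x, 0 ≤ x → x < M → g x < v := by
  have hclosed : IsClosed {x : ℝ | 0 ≤ x ∧ v ≤ g x} :=
    (isClosed_le continuous_const continuous_id).inter (isClosed_le continuous_const hg)
  have hbdd : BddBelow {x : ℝ | 0 ≤ x ∧ v ≤ g x} := ⟨0, fun x hx => hx.1⟩
  have hmem := hclosed.csInf_mem ⟨T, hT, hgT⟩ hbdd
  have hmin : ∀ x, 0 ≤ x → x < sInf {x : ℝ | 0 ≤ x ∧ v ≤ g x} → g x < v := by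
    intro x hx hxM
    by_contra! h
    exact absurd (csInf_le hbdd ⟨hx, h⟩) (not_le.mpr hxM)
  have hle : sInf {x : ℝ | 0 ≤ x ∧ v ≤ g x} ≤ T := csInf_le hbdd ⟨hT, hgT⟩
  generalize sInf {x : ℝ | 0 ≤ x ∧ v ≤ g x} = M at hmem hmin hle
  obtain ⟨hM0, hgM⟩ := hmem
  have hMpos : 0 < M := by
    rcases hM0.eq_or_lt with h | h
    · subst h
      exact absurd h0 (not_lt.mpr hgM)
    · exact h
  refine ⟨M, hMpos, hle, le_antisymm ?_ hgM, hmin⟩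
  obtain ⟨y, ⟨hy0, hyM⟩, hy⟩ := intermediate_value_Icc hM0 hg.continuousOn ⟨h0.le, hgM⟩
  rcases hyM.eq_or_lt with h | h
  · rw [← h, hy]
  · exact absurd hy (hmin y hy0 h).ne

theorem hasDerivAt_F {f : ℝ → ℝ} (hf : Continuous f) (s : ℝ) : HasDerivAt (F f) (f s) s :=
  intervalIntegral.integral_hasDerivAt_right (hf.intervalIntegrable _ _)
    (hf.stronglyMeasurableAtFilter _ _) hf.continuousAt

/-- Conservation of energy along solutions of `u'' + f(u) = 0` on the half-line. -/
theorem energy_conserved {f u : ℝ → ℝ} (hf : Continuous f) (hu : ContDiff ℝ 2 u)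
    (heq : ∀ x : ℝ, 0 ≤ x → deriv (deriv u) x + f (u x) = 0) {x : ℝ} (hx : 0 ≤ x) :
    deriv u x ^ 2 / 2 + F f (u x) = deriv u 0 ^ 2 / 2 + F f (u 0) := by
  have hu1 : Differentiable ℝ u := hu.differentiable (by norm_num)
  have hu2 : Differentiable ℝ (deriv u) :=
    (ContDiff.deriv' (n := 1) (by simpa [one_add_one_eq_two] using hu)).differentiable (by norm_num)
  have hE : ∀ y, HasDerivAt (fun y => deriv u y ^ 2 / 2 + F f (u y))
      (deriv u y * (deriv (deriv u) y + f (u y))) y := by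
    intro y
    have h1 := ((hu2 y).hasDerivAt.pow 2).div_const 2
    have h2 := (hasDerivAt_F hf (u y)).comp y (hu1 y).hasDerivAt
    refine (h1.add h2).congr_deriv ?_
    push_cast
    ring
  refine constant_of_has_deriv_right_zero (a := 0) (b := x)
    (f := fun y => deriv u y ^ 2 / 2 + F f (u y))
    (fun y _ => (hE y).continuousAt.continuousWithinAt) (fun y hy => ?_) x ⟨hx, le_rfl⟩
  have h := hE y
  rw [heq y hy.1, mul_zero] at h
  exact h.hasDerivWithinAt

/-- As long as the trajectory has not exceeded `1`, it stays above `a` and its slope is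
bounded below by the positive constant given by the excess energy. -/
theorem slope_lower_bound {f : ℝ → ℝ} {a : ℝ} (hf : Bistable f a)
    {u : ℝ → ℝ} (hu : ContDiff ℝ 2 u)
    (heq : ∀ x : ℝ, 0 ≤ x → deriv (deriv u) x + f (u x) = 0)
    (h0 : u 0 = a) {c : ℝ} (hc : 0 < c) (hu0 : 0 < deriv u 0)
    (hcE : c ^ 2 + 2 * (F f 1 - F f a) ≤ deriv u 0 ^ 2)
    {T : ℝ} (hT : ∀ x, 0 ≤ x → x ≤ T → u x ≤ 1) {x : ℝ} (hx : 0 ≤ x) (hxT : x ≤ T) :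
    a ≤ u x ∧ c ≤ deriv u x := by
  obtain ⟨hfC, -, -, -, -, -, -, hpos, -⟩ := hf
  have hu1 : Differentiable ℝ u := hu.differentiable (by norm_num)
  have hmono : MonotoneOn (F f) (Icc a 1) := by
    refine monotoneOn_of_deriv_nonneg (convex_Icc a 1)
      (fun s _ => (hasDerivAt_F hfC.continuous s).continuousAt.continuousWithinAt)
      (fun s _ => (hasDerivAt_F hfC.continuous s).differentiableAt.differentiableWithinAt) ?_
    intro s hs
    rw [interior_Icc] at hs
    rw [(hasDerivAt_F hfC.continuous s).deriv]
    exact (hpos s hs.1 hs.2).le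
  have hsq : ∀ y, 0 ≤ y → y ≤ T → a ≤ u y → c ^ 2 ≤ deriv u y ^ 2 := by
    intro y hy hyT hay
    have h1 := energy_conserved hfC.continuous hu heq hy
    have h2 := hT y hy hyT
    have h3 := hmono ⟨hay, h2⟩ ⟨hay.trans h2, le_rfl⟩ h2
    rw [h0] at h1
    linarith
  have hge : ∀ z, 0 ≤ z → (∀ y, 0 ≤ y → y < z → 0 < deriv u y) → a ≤ u z := by
    intro z hz h
    have hm : MonotoneOn u (Icc 0 z) := by
      refine monotoneOn_of_deriv_nonneg (convex_Icc 0 z) hu1.continuous.continuousOn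
        hu1.differentiableOn fun y hy => ?_
      rw [interior_Icc] at hy
      exact (h y hy.1.le hy.2).le
    rw [← h0]
    exact hm ⟨le_rfl, hz⟩ ⟨hz, le_rfl⟩ hz
  have hderiv_pos : ∀ y, 0 ≤ y → y ≤ T → 0 < deriv u y := by
    intro y hy hyT
    by_contra! hneg
    obtain ⟨M, hM, hMy, hM0, hlt⟩ := exists_first_hitting (g := fun y => -deriv u y) (v := 0)
      (hu.continuous_deriv (by norm_num)).neg (neg_lt_zero.mpr hu0) hy (neg_nonneg.mpr hneg)
    have h := hsq M hM.le (hMy.trans hyT)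
      (hge M hM.le fun y hy hyM => neg_lt_zero.mp (hlt y hy hyM))
    rw [neg_eq_zero.mp hM0] at h
    nlinarith
  have hax : a ≤ u x := hge x hx fun y hy hyx => hderiv_pos y hy (hyx.le.trans hxT)
  exact ⟨hax, (sq_le_sq₀ hc.le (hderiv_pos x hx hxT).le).mp (hsq x hx hxT hax)⟩

/-- A trajectory starting at `(a, u'(0))` strictly above the stable manifold of
`(1,0)` reaches the value `1` at a finite length `M₁`. -/
theorem reaches_one_in_finite_length (f : ℝ → ℝ) (a : ℝ) (hf : Bistable f a)
    (u : ℝ → ℝ) (hu : ContDiff ℝ 2 u)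
    (heq : ∀ x : ℝ, 0 ≤ x → deriv (deriv u) x + f (u x) = 0)
    (h0 : u 0 = a)
    (h'0 : Real.sqrt (2 * (F f 1 - F f a)) < deriv u 0) :
    ∃ M₁ : ℝ, 0 < M₁ ∧ u M₁ = 1 ∧
      ∀ x : ℝ, 0 ≤ x → x < M₁ → a ≤ u x ∧ u x < 1 := by
  have ha1 : a < 1 := hf.2.2.1
  have hu0 : 0 < deriv u 0 := (Real.sqrt_nonneg _).trans_lt h'0
  have hu1 : Differentiable ℝ u := hu.differentiable (by norm_num)
  have hgap : 0 < deriv u 0 ^ 2 - 2 * (F f 1 - F f a) := sub_pos.mpr ((Real.sqrt_lt' hu0).mp h'0)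
  obtain ⟨c, hc, hcE⟩ : ∃ c : ℝ, 0 < c ∧ c ^ 2 + 2 * (F f 1 - F f a) ≤ deriv u 0 ^ 2 :=
    ⟨_, Real.sqrt_pos.mpr hgap, by rw [Real.sq_sqrt hgap.le]; linarith⟩
  obtain ⟨T, hT, huT⟩ : ∃ T, 0 ≤ T ∧ 1 ≤ u T := by
    by_contra! hlt
    have hT : 0 ≤ (1 - a) / c := div_nonneg (sub_nonneg.mpr ha1.le) hc.le
    have hgrow := (convex_Icc 0 ((1 - a) / c)).mul_sub_le_image_sub_of_le_deriv
      hu1.continuous.continuousOn hu1.differentiableOn (C := c)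
      (fun x hx => by
        rw [interior_Icc] at hx
        exact (slope_lower_bound hf hu heq h0 hc hu0 hcE (fun y hy _ => (hlt y hy).le)
          hx.1.le hx.2.le).2)
      0 ⟨le_rfl, hT⟩ _ ⟨hT, le_rfl⟩ hT
    rw [sub_zero, mul_div_cancel₀ _ hc.ne', h0] at hgrow
    linarith [hlt _ hT]
  obtain ⟨M, hM, -, huM, hlt⟩ := exists_first_hitting hu.continuous (h0.trans_lt ha1) hT huT
  refine ⟨M, hM, huM, fun x hx hxM => ⟨?_, hlt x hx hxM⟩⟩
  exact (slope_lower_bound hf hu heq h0 hc hu0 hcE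
    (fun y hy hyx => (hlt y hy (hyx.trans_lt hxM)).le) hx le_rfl).1
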